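/- Inside E ⊗_R K one has the equality E + (1/y_1)·E^1 = (1/y_1)·(A_0 ⊕ ⋯ ⊕ A_{m−1}) ⊕ A_m. In particular the echelon modification E_1 := E + (1/y_1)·E^1 is a free R-module of the same rank as E. -/

import Mathlib

open Pointwise

namespace Submodule

section Sup

variable {R V : Type*} [Ring R] [AddCommGroup V] [Module R V]

/-- The sum of two disjoint submodules is isomorphic to their product. -/
noncomputable def prodEquivSupOfDisjoint {p q : Submodule R V} (h : Disjoint p q) :
    (p × q) ≃ₗ[R] ↥(p ⊔ q) :=
  (LinearEquiv.ofInjective (p.subtype.coprod q.subtype) <| by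
    rw [← LinearMap.ker_eq_bot, LinearMap.ker_coprod_of_disjoint_range _ _ (by simpa using h)]
    simp).trans
  (LinearEquiv.ofEq _ _ (by rw [LinearMap.range_coprod, range_subtype, range_subtype]))

/-- The supremum of an independent family of submodules is isomorphic to their direct sum. -/
noncomputable def dfinsuppEquivISup {ι : Type*} [DecidableEq ι] {p : ι → Submodule R V}
    (h : iSupIndep p) : (Π₀ i, p i) ≃ₗ[R] ↥(⨆ i, p i) :=
  (LinearEquiv.ofInjective _ h.dfinsupp_lsum_injective).trans
    (LinearEquiv.ofEq _ _ (iSup_eq_range_dfinsupp_lsum p).symm)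

end Sup

section Smul

variable {R K V : Type*} [CommRing R] [Field K] [Algebra R K]
  [AddCommGroup V] [Module K V] [Module R V] [IsScalarTower R K V]

/-- Scaling by a nonzero element of `K` identifies a submodule with its dilate. -/
noncomputable def equivSMulOfNeZero {c : K} (hc : c ≠ 0) (p : Submodule R V) :
    p ≃ₗ[R] ↥(c • p) :=
  p.equivMapOfInjective (DistribSMul.toLinearMap R V c) (smul_right_injective V hc)

theorem le_inv_algebraMap_smul {r : R} (hr : algebraMap R K r ≠ 0) (p : Submodule R V) :
    p ≤ (algebraMap R K r)⁻¹ • p := by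
  intro v hv
  refine (mem_smul_pointwise_iff_exists _ _ _).2 ⟨r • v, p.smul_mem r hv, ?_⟩
  rw [← algebraMap_smul K r v, inv_smul_smul₀ hr]

theorem inv_algebraMap_smul_mul_smul_le {r : R} (hr : algebraMap R K r ≠ 0) (s : R)
    (p : Submodule R V) : (algebraMap R K r)⁻¹ • (s * r) • p ≤ p := by
  intro v hv
  obtain ⟨w, hw, rfl⟩ := (mem_smul_pointwise_iff_exists _ _ _).1 hv
  obtain ⟨u, hu, rfl⟩ := (mem_smul_pointwise_iff_exists _ _ _).1 hw
  rw [mul_comm, mul_smul, ← algebraMap_smul K r, inv_smul_smul₀ hr]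
  exact p.smul_mem s hu

theorem disjoint_inv_algebraMap_smul {r : R} (hr : algebraMap R K r ≠ 0) {p q : Submodule R V}
    (h : Disjoint p q) : Disjoint ((algebraMap R K r)⁻¹ • p) q := by
  rw [disjoint_def] at h ⊢
  intro v hp hq
  obtain ⟨w, hw, rfl⟩ := (mem_smul_pointwise_iff_exists _ _ _).1 hp
  have hwq := q.smul_mem r hq
  rw [← algebraMap_smul K r, smul_inv_smul₀ hr] at hwq
  rw [h w hw hwq, smul_zero]

end Smul

end Submodule

theorem Fin.iSup_castSucc_sup_last {α : Type*} [CompleteLattice α] {n : ℕ} (f : Fin (n + 1) → α) :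
    ⨆ k, f k = (⨆ k : Fin n, f k.castSucc) ⊔ f (Fin.last n) := by
  refine le_antisymm (iSup_le fun k => ?_)
    (sup_le (iSup_le fun k => le_iSup f k.castSucc) (le_iSup f _))
  induction k using Fin.lastCases with
  | last => exact le_sup_right
  | cast k => exact le_sup_of_le_left (le_iSup (fun k : Fin n => f k.castSucc) k)

/-- Local form of the fact that the first echelon modification
`E₁ = E + (1/y₁)·E¹` equals `(1/y₁)·(A₀ ⊕ ⋯ ⊕ A_{m−1}) ⊕ A_m`, hence is a free
`R`-module of the same rank as `E`. -/
theorem echelon_first_modification_free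
    {R K V : Type*} [CommRing R] [IsDomain R] [Field K] [Algebra R K] [IsFractionRing R K]
    [AddCommGroup V] [Module K V] [Module R V] [IsScalarTower R K V]
    (m : ℕ) (hm : 1 ≤ m)
    (t x y : ℕ → R)
    (htxy : ∀ i ∈ Finset.Icc 1 m, t i ≠ 0 ∧ x i ≠ 0 ∧ y i ≠ 0 ∧ t i = x i * y i)
    (A : ℕ → Submodule R V)
    (hAfree : ∀ k ≤ m, Module.Free R ↥(A k))
    (hAfin : ∀ k ≤ m, Module.Finite R ↥(A k))
    (hindep : iSupIndep fun k : Fin (m + 1) => A k)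
    (E : Submodule R V) (hE : E = ⨆ k : Fin (m + 1), A k)
    (Epow : ℕ → Submodule R V)
    (hEpow : ∀ i ≤ m, Epow i
      = ⨆ k : Fin (m + 1), (∏ j ∈ Finset.Icc (m + 1 - (k : ℕ)) i, t j) • A k) :
    E ⊔ (algebraMap R K (y 1))⁻¹ • Epow 1
        = ((algebraMap R K (y 1))⁻¹ • ⨆ k ∈ Finset.range m, A k) ⊔ A m ∧
      Module.Free R ↥(E ⊔ (algebraMap R K (y 1))⁻¹ • Epow 1) ∧
      Module.Finite R ↥(E ⊔ (algebraMap R K (y 1))⁻¹ • Epow 1) ∧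
      Module.finrank R ↥(E ⊔ (algebraMap R K (y 1))⁻¹ • Epow 1) = Module.finrank R ↥E := by
  obtain ⟨-, -, hy, ht⟩ := htxy 1 (Finset.mem_Icc.2 ⟨le_rfl, hm⟩)
  have hc : algebraMap R K (y 1) ≠ 0 := by simpa using hy
  set P : Submodule R V := ⨆ k : Fin m, A k with hP
  have hrange : ⨆ k ∈ Finset.range m, A k = P := by
    simp only [hP, Finset.mem_range, iSup_subtype', ← Fin.equivSubtype.symm.iSup_comp]
    rfl
  have hEP : E = P ⊔ A m := by
    rw [hE, Fin.iSup_castSucc_sup_last]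
    rfl
  have hE1 : Epow 1 = P ⊔ t 1 • A m := by
    rw [hEpow 1 hm, Fin.iSup_castSucc_sup_last]
    congr 1
    · refine iSup_congr fun k => ?_
      rw [Finset.Icc_eq_empty (by simp; omega), Finset.prod_empty, one_smul]
      rfl
    · simp
  have hdisj : Disjoint P (A m) :=
    (hindep (Fin.last m)).symm.mono_left <| iSup_le fun k =>
      le_iSup₂_of_le k.castSucc (Fin.castSucc_lt_last k).ne le_rfl
  have heq : E ⊔ (algebraMap R K (y 1))⁻¹ • Epow 1 = (algebraMap R K (y 1))⁻¹ • P ⊔ A m := by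
    rw [hEP, hE1, Submodule.smul_sup', sup_sup_sup_comm,
      sup_eq_right.2 (Submodule.le_inv_algebraMap_smul hc P), ht,
      sup_eq_left (a := A m).2 (Submodule.inv_algebraMap_smul_mul_smul_le hc _ _)]
  rw [hrange, heq, hEP]
  have hindepP : iSupIndep fun k : Fin m => A k := hindep.comp (Fin.castSucc_injective m)
  have (k : Fin m) : Module.Free R (A k) := hAfree k k.2.le
  have (k : Fin m) : Module.Finite R (A k) := hAfin k k.2.le
  have := hAfree m le_rfl
  have := hAfin m le_rfl
  have : Module.Free R P := .of_equiv (Submodule.dfinsuppEquivISup hindepP)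
  have : Module.Finite R P := .equiv (Submodule.dfinsuppEquivISup hindepP)
  let e : (P × A m) ≃ₗ[R] ↥((algebraMap R K (y 1))⁻¹ • P ⊔ A m) :=
    ((Submodule.equivSMulOfNeZero (inv_ne_zero hc) P).prodCongr (.refl R _)).trans
      (Submodule.prodEquivSupOfDisjoint (Submodule.disjoint_inv_algebraMap_smul hc hdisj))
  exact ⟨rfl, .of_equiv e, .equiv e,
    (e.symm.trans (Submodule.prodEquivSupOfDisjoint hdisj)).finrank_eq⟩
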